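/- Let a₂, a₃, a₄, a₅, a₆ ∈ ℂ with a₂ + a₄ + a₅ = 1 and with a₂ + a₃ + a₄ not a nonpositive integer. Then for all x¹, x³, x⁴ ∈ ℂ with |x¹| < 1/8, |x³| < 1/8, |x⁴| < 1/8, the triple series defining F_{X₃}(a₂,a₃,a₄,a₅,a₆; x¹, x³, x⁴) and F_D^{(3)}(a₃, a₄, 1−a₆, a₂, 1+a₃−a₅; x³, x⁴, (x³−x¹)/(1−x¹)) converge absolutely, and F_{X₃}(a₂,a₃,a₄,a₅,a₆; x¹, x³, x⁴) = (1−x¹)^(−a₂) · F_D^{(3)}(a₃, a₄, 1−a₆, a₂, 1+a₃−a₅; x³, x⁴, (x³−x¹)/(1−x¹)), where (1−x¹)^(−a₂) is the principal branch. (Series identity from the proof of Proposition A.1.) -/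

import Mathlib

noncomputable section

/-- The ascending Pochhammer symbol `(a)ₙ = a(a+1)⋯(a+n−1)` for a complex number `a`. -/
def poch (a : ℂ) (n : ℕ) : ℂ := (ascPochhammer ℂ n).eval a

/-- General term of the restricted series `F_{X₃}(a₂,a₃,a₄,a₅,a₆; x¹,x³,x⁴)`. -/
def FX3term (a2 a3 a4 a5 a6 x1 x3 x4 : ℂ) (n : ℕ × ℕ × ℕ) : ℂ :=
  poch (1 - a5) (n.1 + n.2.1) * poch (1 - a6) n.2.2 * poch a2 n.1 * poch a3 (n.2.1 + n.2.2) /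
    (poch (a2 + a3 + a4) (n.1 + n.2.1 + n.2.2) *
      (Nat.factorial n.1 : ℂ) * (Nat.factorial n.2.1 : ℂ) * (Nat.factorial n.2.2 : ℂ)) *
    x1 ^ n.1 * x3 ^ n.2.1 * x4 ^ n.2.2

/-- General term of the Lauricella series `F_D^{(3)}(a,b₁,b₂,b₃,c; y¹,y²,y³)`. -/
def FDterm (a b1 b2 b3 c y1 y2 y3 : ℂ) (n : ℕ × ℕ × ℕ) : ℂ :=
  poch a (n.1 + n.2.1 + n.2.2) * poch b1 n.1 * poch b2 n.2.1 * poch b3 n.2.2 /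
    (poch c (n.1 + n.2.1 + n.2.2) *
      (Nat.factorial n.1 : ℂ) * (Nat.factorial n.2.1 : ℂ) * (Nat.factorial n.2.2 : ℂ)) *
    y1 ^ n.1 * y2 ^ n.2.1 * y3 ^ n.2.2

lemma poch_zero (a : ℂ) : poch a 0 = 1 := by simp [poch]

lemma poch_succ (a : ℂ) (n : ℕ) : poch a (n + 1) = poch a n * (a + n) := by
  simp [poch, ascPochhammer_succ_eval]

lemma poch_add (a : ℂ) (n m : ℕ) : poch a (n + m) = poch a n * poch (a + n) m := by
  induction m with
  | zero => simp [poch_zero]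
  | succ m ih =>
    rw [← add_assoc, poch_succ, ih, poch_succ]
    push_cast
    ring

lemma poch_one (n : ℕ) : poch 1 n = (Nat.factorial n : ℂ) := by
  simp [poch]

lemma poch_ne_zero (c : ℂ) (hc : ∀ n : ℕ, c ≠ -(n : ℂ)) (n : ℕ) : poch c n ≠ 0 := by
  induction n with
  | zero => simp [poch_zero]
  | succ n ih =>
    rw [poch_succ]
    refine mul_ne_zero ih fun h => hc n ?_
    linear_combination h

/-- Reflection of the Pochhammer symbol. -/
lemma poch_reflect (n : ℕ) : ∀ x : ℂ, poch (1 - x - n) n = (-1) ^ n * poch x n := by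
  induction n with
  | zero => intro x; simp [poch_zero]
  | succ n ih =>
    intro x
    have h1 : poch x (n + 1) = x * poch (x + 1) n := by
      rw [add_comm n 1, poch_add]
      simp [poch_succ, poch_zero]
    rw [poch_succ, h1]
    have h2 : (1 - x - ((n + 1 : ℕ) : ℂ)) = 1 - (x + 1) - n := by push_cast; ring
    rw [h2, ih]
    ring

/-- Chu-Vandermonde identity. -/
lemma poch_vandermonde (a b : ℂ) (n : ℕ) :
    ∑ ij ∈ Finset.HasAntidiagonal.antidiagonal n, (n.choose ij.1 : ℂ) * (poch a ij.1 * poch b ij.2)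
      = poch (a + b) n := by
  induction n with
  | zero => simp [poch_zero]
  | succ n ih =>
    rw [Finset.sum_antidiagonal_choose_succ_mul (fun i j => poch a i * poch b j) n,
      poch_succ, ← ih, Finset.sum_mul, ← Finset.sum_add_distrib]
    refine Finset.sum_congr rfl fun ij hij => ?_
    have h := Finset.HasAntidiagonal.mem_antidiagonal.1 hij
    have h2 : n.choose ij.2 = n.choose ij.1 := by
      rw [← h, add_comm ij.1 ij.2, Nat.choose_symm_add, add_comm]
    rw [h2, poch_succ, poch_succ]
    rw [← h]
    push_cast
    ring

lemma choose_div_fact {n i j : ℕ} (h : i + j = n) :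
    (n.choose i : ℂ) = (n.factorial : ℂ) / ((i.factorial : ℂ) * (j.factorial : ℂ)) := by
  subst h
  rw [Nat.cast_add_choose]

lemma fact_ne (n : ℕ) : (n.factorial : ℂ) ≠ 0 := by exact_mod_cast Nat.factorial_ne_zero n

lemma poch_vandermonde_div (a b : ℂ) (n : ℕ) :
    ∑ ij ∈ Finset.HasAntidiagonal.antidiagonal n, (poch a ij.1 / (ij.1.factorial : ℂ)) *
      (poch b ij.2 / (ij.2.factorial : ℂ)) = poch (a + b) n / (n.factorial : ℂ) := by
  rw [← poch_vandermonde, Finset.sum_div]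
  refine Finset.sum_congr rfl fun ij hij => ?_
  rw [choose_div_fact (Finset.HasAntidiagonal.mem_antidiagonal.1 hij)]
  have := fact_ne n
  have := fact_ne ij.1
  have := fact_ne ij.2
  field_simp

/-- Terminating Gauss sum. -/
lemma poch_gauss (a c : ℂ) (n : ℕ) (hc : ∀ k, poch c k ≠ 0) :
    ∑ ij ∈ Finset.HasAntidiagonal.antidiagonal n, (-1) ^ ij.1 * (poch a ij.1 / poch c ij.1) /
      ((ij.1.factorial : ℂ) * (ij.2.factorial : ℂ)) =
      poch (c - a) n / poch c n / (n.factorial : ℂ) := by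
  have h := poch_vandermonde a (1 - c - n) n
  have h2 : a + (1 - c - n) = 1 - (c - a) - n := by ring
  rw [h2, poch_reflect] at h
  have h3 : poch (c - a) n = (-1) ^ n * ((-1) ^ n * poch (c - a) n) := by
    rw [← mul_assoc, ← mul_pow]; simp
  rw [h3, ← h, Finset.mul_sum, Finset.sum_div, Finset.sum_div]
  refine Finset.sum_congr rfl fun ij hij => ?_
  have hs := Finset.HasAntidiagonal.mem_antidiagonal.1 hij
  rw [choose_div_fact hs]
  have e1 : poch c n = poch c ij.1 * poch (c + ij.1) ij.2 := by rw [← hs, poch_add]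
  have e2 : (1 - c - n : ℂ) = 1 - (c + ij.1) - ij.2 := by rw [← hs]; push_cast; ring
  have e3 : ((-1 : ℂ)) ^ n = (-1) ^ ij.1 * (-1) ^ ij.2 := by rw [← hs, pow_add]
  have e4 : ((-1 : ℂ)) ^ ij.2 * (-1) ^ ij.2 = 1 := by rw [← mul_pow]; simp
  have e5 : poch (c + ij.1) ij.2 ≠ 0 := fun h0 => hc n (by rw [e1, h0, mul_zero])
  rw [e2, poch_reflect, e1, e3]
  have := fact_ne n
  have := fact_ne ij.1
  have := fact_ne ij.2
  have := hc ij.1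
  field_simp
  linear_combination (-(poch a ij.1)) * e4

lemma growth (u : ℕ → ℂ) (N : ℕ) (h : ∀ n, N ≤ n → ‖u (n + 1)‖ ≤ 5 / 4 * ‖u n‖) :
    ∃ K : ℝ, 0 ≤ K ∧ ∀ n, ‖u n‖ ≤ K * (5 / 4) ^ n := by
  refine ⟨∑ k ∈ Finset.range (N + 1), ‖u k‖, Finset.sum_nonneg fun _ _ => norm_nonneg _, ?_⟩
  have hs : ∀ n, n ≤ N → ‖u n‖ ≤ ∑ k ∈ Finset.range (N + 1), ‖u k‖ := fun n hn =>
    Finset.single_le_sum (f := fun k => ‖u k‖) (fun _ _ => norm_nonneg _)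
      (Finset.mem_range.2 (by omega))
  intro n
  induction n with
  | zero => simpa using hs 0 (Nat.zero_le _)
  | succ n ih =>
    rcases Nat.lt_or_ge n N with hn | hn
    · refine (hs (n + 1) hn).trans (le_mul_of_one_le_right
        (Finset.sum_nonneg fun _ _ => norm_nonneg _) (one_le_pow₀ (by norm_num)))
    · refine (h n hn).trans ?_
      rw [pow_succ]
      linarith

lemma poch_ratio_bound (a c : ℂ) :
    ∃ K : ℝ, 0 ≤ K ∧ ∀ n, ‖poch a n / poch c n‖ ≤ K * (5 / 4) ^ n := by
  obtain ⟨N, hN⟩ := exists_nat_gt (4 * ‖a‖ + 5 * ‖c‖)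
  refine growth _ N fun n hn => ?_
  have hn' : (N : ℝ) ≤ n := by exact_mod_cast hn
  have h1 : ‖a + n‖ ≤ ‖a‖ + n := (norm_add_le _ _).trans (by simp)
  have h2 : (n : ℝ) - ‖c‖ ≤ ‖c + n‖ := by
    have := norm_sub_le (c + n) c
    simp at this
    linarith
  have hpos : 0 < ‖c + n‖ := by
    have := norm_nonneg a
    have := norm_nonneg c
    linarith
  rw [poch_succ, poch_succ, mul_div_mul_comm, norm_mul, mul_comm]
  refine mul_le_mul_of_nonneg_right ?_ (norm_nonneg _)
  rw [norm_div, div_le_iff₀ hpos]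
  linarith

lemma poch_fact_bound (a : ℂ) :
    ∃ K : ℝ, 0 ≤ K ∧ ∀ n : ℕ, ‖poch a n / (n.factorial : ℂ)‖ ≤ K * (5 / 4) ^ n := by
  obtain ⟨K, h0, h⟩ := poch_ratio_bound a 1
  exact ⟨K, h0, fun n => by rw [← poch_one]; exact h n⟩

lemma hasSum_antidiag {β : Type*} {f : (ℕ × ℕ) × β → ℂ} {S : ℂ} (h : HasSum f S) :
    HasSum (fun x : ℕ × β => ∑ p ∈ Finset.HasAntidiagonal.antidiagonal x.1, f (p, x.2)) S := by
  let e : (Σ x : ℕ × β, {p : ℕ × ℕ // p ∈ Finset.HasAntidiagonal.antidiagonal x.1}) ≃ (ℕ × ℕ) × β :=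
    { toFun := fun y => (y.2.1, y.1.2)
      invFun := fun z => ⟨(z.1.1 + z.1.2, z.2), ⟨z.1, Finset.HasAntidiagonal.mem_antidiagonal.2 rfl⟩⟩
      left_inv := by
        rintro ⟨⟨n, b⟩, ⟨⟨p, q⟩, hp⟩⟩
        obtain rfl := Finset.HasAntidiagonal.mem_antidiagonal.1 hp
        rfl
      right_inv := fun z => rfl }
  refine HasSum.sigma (f := f ∘ e) ((Equiv.hasSum_iff e).2 h) fun x => ?_
  rw [← Finset.sum_coe_sort]
  exact hasSum_fintype _

lemma binom_series (a x : ℂ) (hx : ‖x‖ < 1) :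
    HasSum (fun m : ℕ => poch a m / (m.factorial : ℂ) * x ^ m) ((1 - x) ^ (-a)) := by
  have h := (Complex.one_div_one_sub_cpow_hasFPowerSeriesOnBall_zero a).hasSum (y := x)
    (by simpa [Metric.mem_eball, edist_zero_right, enorm_eq_nnnorm, ← NNReal.coe_lt_coe] using hx)
  rw [Complex.cpow_neg, ← one_div]
  simp only [zero_add] at h
  convert! h using 1
  funext m
  have hh : poch a m = (m.factorial : ℂ) * Ring.choose (a + m - 1) m := by
    rw [← Ring.multichoose_eq]
    have := Ring.factorial_nsmul_multichoose_eq_ascPochhammer a m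
    rw [Polynomial.ascPochhammer_smeval_eq_eval] at this
    rw [poch, ← this, nsmul_eq_mul]
  rw [hh, FormalMultilinearSeries.ofScalars_apply_eq]
  have := fact_ne m
  field_simp
  simp

/-- The five-fold general term. -/
def T5 (a2 a3 a4 b c x1 x3 x4 : ℂ) (i j p q m : ℕ) : ℂ :=
  (poch a3 (i + j + p + q) / poch c (i + j + p + q)) * (poch a4 i / (i.factorial : ℂ)) *
    (poch b j / (j.factorial : ℂ)) *
    (poch a2 (p + q + m) / ((p.factorial : ℂ) * (q.factorial : ℂ) * (m.factorial : ℂ))) *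
    ((-1) ^ q * x3 ^ (i + p) * x4 ^ j * x1 ^ (q + m))

lemma fact_bound (p q m : ℕ) :
    ((p + q + m).factorial : ℝ) ≤
      4 ^ (p + q + m) * ((p.factorial : ℝ) * q.factorial * m.factorial) := by
  have h1 : (p + q + m).factorial ≤ 2 ^ (p + q + m) * ((p + q).factorial * m.factorial) := by
    rw [← Nat.add_choose_mul_factorial_mul_factorial, mul_assoc]
    exact Nat.mul_le_mul_right _ (Nat.choose_le_two_pow _ _)
  have h2 : (p + q).factorial ≤ 2 ^ (p + q + m) * (p.factorial * q.factorial) := by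
    rw [← Nat.add_choose_mul_factorial_mul_factorial, mul_assoc]
    exact Nat.mul_le_mul_right _ ((Nat.choose_le_two_pow _ _).trans
      (Nat.pow_le_pow_right (by norm_num) (by omega)))
  have h3 : (p + q + m).factorial ≤
      4 ^ (p + q + m) * (p.factorial * q.factorial * m.factorial) := by
    calc _ ≤ _ := h1
      _ ≤ 2 ^ (p + q + m) * ((2 ^ (p + q + m) * (p.factorial * q.factorial)) * m.factorial) := by
          gcongr
      _ = _ := by
          rw [show 4 = 2 * 2 by norm_num, mul_pow]; ring
  exact_mod_cast h3

lemma T5_summable (a2 a3 a4 b c x1 x3 x4 : ℂ)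
    (hx1 : ‖x1‖ < 1 / 8) (hx3 : ‖x3‖ < 1 / 8) (hx4 : ‖x4‖ < 1 / 8) :
    Summable (fun n : ℕ × ℕ × ℕ × ℕ × ℕ =>
      T5 a2 a3 a4 b c x1 x3 x4 n.1 n.2.1 n.2.2.1 n.2.2.2.1 n.2.2.2.2) := by
  obtain ⟨K1, hK1, h1⟩ := poch_ratio_bound a3 c
  obtain ⟨K2, hK2, h2⟩ := poch_fact_bound a4
  obtain ⟨K3, hK3, h3⟩ := poch_fact_bound b
  obtain ⟨K4, hK4, h4⟩ := poch_fact_bound a2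
  set s : ℝ := 25 / 32 with hs
  have hs0 : ∀ n : ℕ, 0 ≤ s ^ n := fun n => by positivity
  have g : Summable (fun n : ℕ => s ^ n) :=
    summable_geometric_of_lt_one (by norm_num [hs]) (by norm_num [hs])
  have g2 := g.mul_of_nonneg g hs0 hs0
  have g3 := g.mul_of_nonneg g2 hs0 (fun x => mul_nonneg (hs0 _) (hs0 _))
  have g4 := g.mul_of_nonneg g3 hs0 (fun x => mul_nonneg (hs0 _) (mul_nonneg (hs0 _) (hs0 _)))
  have g5 := g.mul_of_nonneg g4 hs0 (fun x => mul_nonneg (hs0 _)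
    (mul_nonneg (hs0 _) (mul_nonneg (hs0 _) (hs0 _))))
  refine Summable.of_norm_bounded (g5.mul_left (K1 * K2 * K3 * K4)) ?_
  rintro ⟨i, j, p, q, m⟩
  simp only [T5]
  have h4' : ‖poch a2 (p + q + m) / ((p.factorial : ℂ) * (q.factorial : ℂ) * (m.factorial : ℂ))‖
      ≤ K4 * (5 / 4) ^ (p + q + m) * 4 ^ (p + q + m) := by
    have hf : (0 : ℝ) < (p + q + m).factorial := by exact_mod_cast Nat.factorial_pos _
    have hf2 : (0 : ℝ) < (p.factorial : ℝ) * q.factorial * m.factorial := by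
      exact_mod_cast Nat.mul_pos (Nat.mul_pos (Nat.factorial_pos _) (Nat.factorial_pos _))
        (Nat.factorial_pos _)
    have hh := h4 (p + q + m)
    rw [norm_div, Complex.norm_natCast, div_le_iff₀ hf] at hh
    rw [norm_div, norm_mul, norm_mul, Complex.norm_natCast, Complex.norm_natCast,
      Complex.norm_natCast, div_le_iff₀ hf2]
    refine hh.trans ?_
    rw [mul_assoc (K4 * _)]
    exact mul_le_mul_of_nonneg_left (fact_bound p q m) (by positivity)
  have h5 : ‖(-1) ^ q * x3 ^ (i + p) * x4 ^ j * x1 ^ (q + m)‖ ≤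
      (1 / 8 : ℝ) ^ (i + p) * (1 / 8) ^ j * (1 / 8) ^ (q + m) := by
    simp only [norm_mul, norm_pow, norm_neg, norm_one, one_pow, one_mul]
    gcongr
  rw [norm_mul, norm_mul, norm_mul, norm_mul]
  calc _ ≤ (K1 * (5 / 4) ^ (i + j + p + q)) * (K2 * (5 / 4) ^ i) * (K3 * (5 / 4) ^ j) *
        (K4 * (5 / 4) ^ (p + q + m) * 4 ^ (p + q + m)) *
        ((1 / 8 : ℝ) ^ (i + p) * (1 / 8) ^ j * (1 / 8) ^ (q + m)) := by
        gcongr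
        · exact h1 _
        · exact h2 _
        · exact h3 _
    _ = K1 * K2 * K3 * K4 * ((25 / 128) ^ i * ((25 / 128) ^ j * (s ^ p * (s ^ q * (5 / 8) ^ m)))) := by
        have e1 : (25 / 128 : ℝ) = 5 / 4 * (5 / 4) * (1 / 8) := by norm_num
        have e2 : s = 5 / 4 * (5 / 4) * 4 * (1 / 8) := by norm_num [hs]
        have e3 : (5 / 8 : ℝ) = 5 / 4 * 4 * (1 / 8) := by norm_num
        rw [e1, e2, e3]
        simp only [mul_pow, pow_add]
        ring
    _ ≤ K1 * K2 * K3 * K4 * (s ^ i * (s ^ j * (s ^ p * (s ^ q * s ^ m)))) := by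
        have hs' : 0 ≤ s := by norm_num [hs]
        gcongr <;> norm_num [hs]

lemma T5_left (a2 a3 a4 a5 a6 : ℂ) (hsum : a2 + a4 + a5 = 1)
    (hc : ∀ n : ℕ, a2 + a3 + a4 ≠ -(n : ℂ)) (x1 x3 x4 : ℂ) (n1 n3 j : ℕ) :
    ∑ qm ∈ Finset.HasAntidiagonal.antidiagonal n1, ∑ ip ∈ Finset.HasAntidiagonal.antidiagonal n3,
      T5 a2 a3 a4 (1 - a6) (a2 + a3 + a4) x1 x3 x4 ip.1 j ip.2 qm.1 qm.2 =
    FX3term a2 a3 a4 a5 a6 x1 x3 x4 (n1, n3, j) := by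
  have hb : 1 - a5 = a4 + a2 := by linear_combination -hsum
  set c := a2 + a3 + a4 with hcdef
  have hcn := poch_ne_zero c hc
  have hcn' : ∀ k, poch (c + (n3 + j : ℕ)) k ≠ 0 := fun k h0 =>
    hcn (n3 + j + k) (by rw [poch_add, h0, mul_zero])
  have V := poch_vandermonde_div a4 (a2 + n1) n3
  have G := poch_gauss (a3 + (n3 + j : ℕ)) (c + (n3 + j : ℕ)) n1 hcn'
  have hCA : c + (n3 + j : ℕ) - (a3 + (n3 + j : ℕ)) = a4 + a2 := by rw [hcdef]; ring
  rw [hCA] at G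
  have key : ∀ qm ∈ Finset.HasAntidiagonal.antidiagonal n1, ∀ ip ∈ Finset.HasAntidiagonal.antidiagonal n3,
      T5 a2 a3 a4 (1 - a6) c x1 x3 x4 ip.1 j ip.2 qm.1 qm.2 =
      (poch a3 (n3 + j) / poch c (n3 + j) * (poch (1 - a6) j / (j.factorial : ℂ)) * poch a2 n1 *
        (x3 ^ n3 * x4 ^ j * x1 ^ n1)) *
      (((-1) ^ qm.1 * (poch (a3 + (n3 + j : ℕ)) qm.1 / poch (c + (n3 + j : ℕ)) qm.1) /
      ((qm.1.factorial : ℂ) * (qm.2.factorial : ℂ))) *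
      ((poch a4 ip.1 / (ip.1.factorial : ℂ)) *
      (poch (a2 + n1) ip.2 / (ip.2.factorial : ℂ)))) := by
    rintro ⟨q, m⟩ hqm ⟨i, p⟩ hip
    rw [Finset.HasAntidiagonal.mem_antidiagonal] at hqm hip
    simp only at hqm hip ⊢
    have e1 : i + j + p + q = (n3 + j) + q := by omega
    have e2 : p + q + m = n1 + p := by omega
    rw [T5, e1, e2, hip, hqm, poch_add a3, poch_add c, poch_add a2]
    have := fact_ne i
    have := fact_ne p
    have := fact_ne q
    have := fact_ne m
    have := fact_ne j
    have := hcn (n3 + j)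
    have := hcn' q
    field_simp
  rw [Finset.sum_congr rfl fun qm hqm => Finset.sum_congr rfl (key qm hqm)]
  simp only [← Finset.mul_sum]
  rw [V, ← Finset.sum_mul, G]
  simp only [FX3term]
  rw [← hcdef, hb, show a4 + (a2 + (n1 : ℂ)) = a4 + a2 + n1 by ring, poch_add (a4 + a2),
    show n1 + n3 + j = (n3 + j) + n1 by ring, poch_add c (n3 + j) n1]
  have := fact_ne n1
  have := fact_ne n3
  have := fact_ne j
  have := hcn (n3 + j)
  have := hcn' n1
  field_simp

lemma T5_right (a2 a3 a4 b c : ℂ) (x1 x3 x4 : ℂ) (hx1 : ‖x1‖ < 1) (i j k : ℕ) :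
    HasSum (fun m : ℕ => ∑ pq ∈ Finset.HasAntidiagonal.antidiagonal k,
      T5 a2 a3 a4 b c x1 x3 x4 i j pq.1 pq.2 m)
    ((1 - x1) ^ (-a2) * FDterm a3 a4 b a2 c x3 x4 ((x3 - x1) / (1 - x1)) (i, j, k)) := by
  have hne : 1 - x1 ≠ 0 := by
    intro h
    have : x1 = 1 := by linear_combination -h
    rw [this] at hx1
    simp at hx1
  have B := binom_series (a2 + k) x1 hx1
  have hp : (x3 - x1) ^ k / (k.factorial : ℂ) = ∑ pq ∈ Finset.HasAntidiagonal.antidiagonal k,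
      (-1) ^ pq.2 * x3 ^ pq.1 * x1 ^ pq.2 / ((pq.1.factorial : ℂ) * (pq.2.factorial : ℂ)) := by
    rw [sub_eq_add_neg, (Commute.all x3 (-x1)).add_pow', Finset.sum_div]
    refine Finset.sum_congr rfl fun pq hpq => ?_
    rw [nsmul_eq_mul, choose_div_fact (Finset.HasAntidiagonal.mem_antidiagonal.1 hpq), neg_pow x1]
    have := fact_ne k
    have := fact_ne pq.1
    have := fact_ne pq.2
    field_simp
  have hpow : (1 - x1) ^ (-(a2 + k)) = (1 - x1) ^ (-a2) / (1 - x1) ^ k := by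
    rw [neg_add, ← sub_eq_add_neg, Complex.cpow_sub _ _ hne, Complex.cpow_natCast]
  rw [hpow] at B
  have B2 := B.mul_left ((poch a3 (i + j + k) / poch c (i + j + k)) *
    (poch a4 i / (i.factorial : ℂ)) * (poch b j / (j.factorial : ℂ)) * poch a2 k *
    (x3 ^ i * x4 ^ j) * ((x3 - x1) ^ k / (k.factorial : ℂ)))
  convert! B2 using 1
  · funext m
    rw [hp, Finset.mul_sum, Finset.sum_mul]
    refine Finset.sum_congr rfl ?_
    rintro ⟨p, q⟩ hpq
    rw [Finset.HasAntidiagonal.mem_antidiagonal] at hpq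
    simp only at hpq ⊢
    rw [T5, show i + j + p + q = i + j + k by omega, hpq, poch_add a2 k m, pow_add, pow_add]
    simp only [div_eq_mul_inv, mul_inv]
    ring
  · simp only [FDterm, div_pow]
    simp only [div_eq_mul_inv, mul_inv]
    ring

/-- Series identity from the proof of Proposition A.1: if `a₂+a₄+a₅ = 1` then
`F_{X₃}(a₂,a₃,a₄,a₅,a₆; x¹,x³,x⁴)
  = (1−x¹)^(−a₂) F_D^{(3)}(a₃, a₄, 1−a₆, a₂, 1+a₃−a₅; x³, x⁴, (x³−x¹)/(1−x¹))`,
with absolute convergence of both triple series, for `|x¹|, |x³|, |x⁴| < 1/8`. -/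
theorem stmt18 (a2 a3 a4 a5 a6 : ℂ) (hsum : a2 + a4 + a5 = 1)
    (hc : ∀ n : ℕ, a2 + a3 + a4 ≠ -(n : ℂ))
    (x1 x3 x4 : ℂ)
    (hx1 : ‖x1‖ < 1 / 8) (hx3 : ‖x3‖ < 1 / 8)
    (hx4 : ‖x4‖ < 1 / 8) :
    Summable (fun n : ℕ × ℕ × ℕ => ‖FX3term a2 a3 a4 a5 a6 x1 x3 x4 n‖) ∧
    Summable (fun n : ℕ × ℕ × ℕ =>
      ‖FDterm a3 a4 (1 - a6) a2 (1 + a3 - a5) x3 x4 ((x3 - x1) / (1 - x1)) n‖) ∧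
    ∑' n : ℕ × ℕ × ℕ, FX3term a2 a3 a4 a5 a6 x1 x3 x4 n =
      (1 - x1) ^ (-a2) *
        ∑' n : ℕ × ℕ × ℕ,
          FDterm a3 a4 (1 - a6) a2 (1 + a3 - a5) x3 x4 ((x3 - x1) / (1 - x1)) n := by
  have hcc : 1 + a3 - a5 = a2 + a3 + a4 := by linear_combination -hsum
  rw [hcc]
  have hx1' : ‖x1‖ < 1 := hx1.trans (by norm_num)
  obtain ⟨S, hS⟩ := T5_summable a2 a3 a4 (1 - a6) (a2 + a3 + a4) x1 x3 x4 hx1 hx3 hx4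
  have hL : HasSum (FX3term a2 a3 a4 a5 a6 x1 x3 x4) S := by
    let e1 : (ℕ × ℕ) × ((ℕ × ℕ) × ℕ) ≃ ℕ × ℕ × ℕ × ℕ × ℕ :=
      { toFun := fun z => (z.1.1, z.2.2, z.1.2, z.2.1.1, z.2.1.2)
        invFun := fun n => ((n.1, n.2.2.1), ((n.2.2.2.1, n.2.2.2.2), n.2.1))
        left_inv := fun _ => rfl
        right_inv := fun _ => rfl }
    let e2 : (ℕ × ℕ) × (ℕ × ℕ) ≃ ℕ × ((ℕ × ℕ) × ℕ) :=
      { toFun := fun z => (z.2.1, (z.1, z.2.2))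
        invFun := fun n => (n.2.1, (n.1, n.2.2))
        left_inv := fun _ => rfl
        right_inv := fun _ => rfl }
    have h1 := hasSum_antidiag ((Equiv.hasSum_iff e1).2 hS)
    have h2 := hasSum_antidiag ((Equiv.hasSum_iff e2).2 h1)
    refine h2.congr_fun ?_
    rintro ⟨n1, n3, j⟩
    exact (T5_left a2 a3 a4 a5 a6 hsum hc x1 x3 x4 n1 n3 j).symm
  have hR : HasSum (fun n => (1 - x1) ^ (-a2) *
      FDterm a3 a4 (1 - a6) a2 (a2 + a3 + a4) x3 x4 ((x3 - x1) / (1 - x1)) n) S := by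
    let e1 : (ℕ × ℕ) × (ℕ × ℕ × ℕ) ≃ ℕ × ℕ × ℕ × ℕ × ℕ :=
      { toFun := fun z => (z.2.1, z.2.2.1, z.1.1, z.1.2, z.2.2.2)
        invFun := fun n => ((n.2.2.1, n.2.2.2.1), (n.1, n.2.1, n.2.2.2.2))
        left_inv := fun _ => rfl
        right_inv := fun _ => rfl }
    let e2 : (ℕ × ℕ × ℕ) × ℕ ≃ ℕ × (ℕ × ℕ × ℕ) :=
      { toFun := fun z => (z.1.2.2, (z.1.1, z.1.2.1, z.2))
        invFun := fun n => ((n.2.1, n.2.2.1, n.1), n.2.2.2)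
        left_inv := fun _ => rfl
        right_inv := fun _ => rfl }
    have h1 := hasSum_antidiag ((Equiv.hasSum_iff e1).2 hS)
    refine HasSum.prod_fiberwise ((Equiv.hasSum_iff e2).2 h1) ?_
    rintro ⟨i, j, k⟩
    exact T5_right a2 a3 a4 (1 - a6) (a2 + a3 + a4) x1 x3 x4 hx1' i j k
  have hne : 1 - x1 ≠ 0 := by
    intro h
    have : x1 = 1 := by linear_combination -h
    rw [this] at hx1'
    simp at hx1'
  have hne2 : (1 - x1) ^ (-a2) ≠ 0 := by
    rw [Complex.cpow_def_of_ne_zero hne]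
    exact Complex.exp_ne_zero _
  refine ⟨summable_norm_iff.2 hL.summable, summable_norm_iff.2 ?_, ?_⟩
  · exact (summable_mul_left_iff hne2).1 hR.summable
  · rw [← tsum_mul_left, hL.tsum_eq, hR.tsum_eq]
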